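/- Consider the k-user MISO BC with hybrid CSIT where 𝒫 = {1,…,|𝒫|}, 𝒟 = {|𝒫|+1,…,|𝒫|+|𝒟|} with |𝒟| ≥ 1, and 𝒩 = {|𝒫|+|𝒟|+1,…,k}. For every linear coding strategy of block length n, almost surely rank[ [G_1^n; … ; G_k^n] · [V_1^n … V_{|𝒫|}^n] ] / k ≤ rank[ [G_{|𝒫|+1}^n; … ; G_{|𝒫|+|𝒟|}^n] · [V_1^n … V_{|𝒫|}^n] ] / |𝒟|, where [A;B] denotes vertical concatenation and [V_1^n … V_{|𝒫|}^n] horizontal concatenation. -/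

import Mathlib

open MeasureTheory Matrix Filter Topology

noncomputable section

/-- CSIT state of a receiver: instantaneous (`P`), delayed (`D`), or none (`N`). -/
inductive CSITState : Type
  | P : CSITState
  | D : CSITState
  | N : CSITState
  deriving DecidableEq

/-- A channel realization: for each receiver `j`, time slot `t` and transmit antenna `a`,
the channel coefficient `g j t a`. -/
abbrev Chan (k m n : ℕ) : Type := Fin k → Fin n → Fin m → ℂ

/-- Joint law of the channel coefficients: all entries i.i.d. with common law `μ`. -/
def chanMeasure (k m n : ℕ) (μ : Measure ℂ) : Measure (Chan k m n) :=
  Measure.pi fun _ : Fin k => Measure.pi fun _ : Fin n => Measure.pi fun _ : Fin m => μ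

/-- The block-diagonal channel matrix `G_j^n ∈ ℂ^{n × nm}` of a receiver with
channel vectors `g (t) ∈ ℂ^{1 × m}`. -/
def blockDiag {m n : ℕ} (g : Fin n → Fin m → ℂ) : Matrix (Fin n) (Fin n × Fin m) ℂ :=
  Matrix.of fun t p => if p.1 = t then g t p.2 else 0

/-- A linear coding strategy of block length `n` for the `k`-user MISO BC with `m`
transmit antennas and hybrid CSIT configuration `I`. -/
structure Strategy (k m n : ℕ) (I : Fin k → CSITState) : Type where
  /-- number of information symbols `m_j(n)` for receiver `j` -/
  dim : Fin k → ℕ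
  /-- precoding matrix `V_j(t) ∈ ℂ^{m × m_j(n)}`, a function of the channel realization -/
  pre : (j : Fin k) → Fin n → Chan k m n → Matrix (Fin m) (Fin (dim j)) ℂ
  /-- each precoder is a measurable function of the channels -/
  meas : ∀ j t a c, Measurable fun g => pre j t g a c
  /-- `V_j(t)` depends only on the CSIT available at time `t`: current and past channels of
  receivers with instantaneous CSIT, and strictly past channels of receivers with delayed
  CSIT (and nothing from receivers with no CSIT). -/
  causal : ∀ (j : Fin k) (t : Fin n) (g g' : Chan k m n),
    (∀ i, I i = CSITState.P → ∀ s : Fin n, (s : ℕ) ≤ (t : ℕ) → g i s = g' i s) →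
    (∀ i, I i = CSITState.D → ∀ s : Fin n, (s : ℕ) < (t : ℕ) → g i s = g' i s) →
    pre j t g = pre j t g'

namespace Strategy

variable {k m n : ℕ} {I : Fin k → CSITState}

/-- The overall precoding matrix `V_j^n ∈ ℂ^{nm × m_j(n)}` (vertical concatenation of the
`V_j(t)`). -/
def Vn (f : Strategy k m n I) (j : Fin k) (g : Chan k m n) :
    Matrix (Fin n × Fin m) (Fin (f.dim j)) ℂ :=
  Matrix.of fun r c => f.pre j r.1 g r.2 c

/-- Horizontal concatenation `[∪_{i ∈ S} V_i^n]` of the precoding matrices of the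
receivers in `S`. -/
def VS (f : Strategy k m n I) (S : Finset (Fin k)) (g : Chan k m n) :
    Matrix (Fin n × Fin m) ((i : {x // x ∈ S}) × Fin (f.dim i.1)) ℂ :=
  Matrix.of fun r c => f.Vn c.1.1 g r c.2

/-- The received-signal matrix `G_j^n [∪_{i ∈ S} V_i^n]` at receiver `j`. -/
def recvS (f : Strategy k m n I) (S : Finset (Fin k)) (j : Fin k) (g : Chan k m n) :
    Matrix (Fin n) ((i : {x // x ∈ S}) × Fin (f.dim i.1)) ℂ :=
  blockDiag (g j) * f.VS S g

/-- The received-signal matrix `G_j^n V_j^n` at receiver `j` from its own precoder. -/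
def recv1 (f : Strategy k m n I) (j : Fin k) (g : Chan k m n) :
    Matrix (Fin n) (Fin (f.dim j)) ℂ :=
  blockDiag (g j) * f.Vn j g

/-- `G_j^t [∪_{i ∈ S} V_i^t]`: the received signal matrix restricted to the first `t`
time slots (rows beyond `t` set to zero, so that its rank is that of the truncated
matrix, with the `t = 0` convention of rank `0`). -/
def recvUpTo (f : Strategy k m n I) (S : Finset (Fin k)) (j : Fin k)
    (g : Chan k m n) (t : ℕ) :
    Matrix (Fin n) ((i : {x // x ∈ S}) × Fin (f.dim i.1)) ℂ :=
  Matrix.of fun s c => if (s : ℕ) < t then f.recvS S j g s c else 0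

/-- Decodability: for every receiver `j`, almost surely
`rank[G_j^n[∪_i V_i^n]] − rank[G_j^n[∪_{i ≠ j} V_i^n]] = rank[G_j^n V_j^n] = m_j(n)`. -/
def Decodable (f : Strategy k m n I) (μ : Measure ℂ) : Prop :=
  ∀ j : Fin k, ∀ᵐ g ∂ chanMeasure k m n μ,
    (f.recvS Finset.univ j g).rank - (f.recvS (Finset.univ.erase j) j g).rank
        = (f.recv1 j g).rank ∧
    (f.recv1 j g).rank = f.dim j

end Strategy

/-- A DoF tuple is linearly achievable if there is a sequence of decodable strategies
achieving it in the limit. -/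
def LinAchievable (k m : ℕ) (I : Fin k → CSITState) (μ : Measure ℂ) (d : Fin k → ℝ) : Prop :=
  (∀ j, 0 ≤ d j ∧ d j ≤ 1) ∧
  ∃ F : (n : ℕ) → Strategy k m n I,
    (∀ n, (F n).Decodable μ) ∧
    ∀ j, Tendsto (fun n : ℕ => ((F n).dim j : ℝ) / n) atTop (nhds (d j))

/-- The linear degrees-of-freedom region: closure of the set of linearly achievable tuples. -/
def LDoFRegion (k m : ℕ) (I : Fin k → CSITState) (μ : Measure ℂ) : Set (Fin k → ℝ) :=
  closure {d | LinAchievable k m I μ d}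

/-- The linear sum degrees of freedom. -/
def LDoFSum (k m : ℕ) (I : Fin k → CSITState) (μ : Measure ℂ) : ℝ :=
  sSup ((fun d => ∑ j, d j) '' LDoFRegion k m I μ)

/-- The set `𝒫` of receivers supplying instantaneous CSIT. -/
def stateP (k : ℕ) (I : Fin k → CSITState) : Finset (Fin k) :=
  Finset.univ.filter fun i => I i = CSITState.P

/-- The set `𝒟` of receivers supplying delayed CSIT. -/
def stateD (k : ℕ) (I : Fin k → CSITState) : Finset (Fin k) :=
  Finset.univ.filter fun i => I i = CSITState.D

/-- The set `𝒩` of receivers supplying no CSIT. -/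
def stateN (k : ℕ) (I : Fin k → CSITState) : Finset (Fin k) :=
  Finset.univ.filter fun i => I i = CSITState.N


/-- Submodularity of the dimension: enlarging `L` can only shrink the gain from adding `R`. -/
theorem finrank_sup_add_finrank_le_of_le {K E : Type*} [Field K] [AddCommGroup E] [Module K E]
    [FiniteDimensional K E] (R : Submodule K E) {L M : Submodule K E} (h : L ≤ M) :
    Module.finrank K ↥(R ⊔ M) + Module.finrank K L
      ≤ Module.finrank K ↥(R ⊔ L) + Module.finrank K M := by
  have h1 := Submodule.finrank_sup_add_finrank_inf_eq R M
  have h2 := Submodule.finrank_sup_add_finrank_inf_eq R L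
  have h3 := Submodule.finrank_mono (inf_le_inf_left R h)
  omega

/-- If the vectors `r (d q) t` are in general position in `R t` relative to the span of their
lexicographic predecessors, then the selected family carries at least a proportion `dd / k`
of the total dimension. -/
theorem mul_finrank_span_le_of_generic {K E : Type*} [Field K] [AddCommGroup E] [Module K E]
    [FiniteDimensional K E] {k dd n : ℕ} (hk : dd ≤ k) (R : Fin n → Submodule K E)
    (r : Fin k → Fin n → E) (d : Fin dd → Fin k) (hr : ∀ j t, r j t ∈ R t)
    (hgen : ∀ t q, R t ≤ Submodule.span K
        ((fun x : Fin dd × Fin n => r (d x.1) x.2) '' {x | x.2 < t ∨ x.2 = t ∧ x.1 < q}) ∨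
      r (d q) t ∉ Submodule.span K
        ((fun x : Fin dd × Fin n => r (d x.1) x.2) '' {x | x.2 < t ∨ x.2 = t ∧ x.1 < q})) :
    dd * Module.finrank K (Submodule.span K (Set.range fun x : Fin k × Fin n => r x.1 x.2))
      ≤ k * Module.finrank K
        (Submodule.span K (Set.range fun x : Fin dd × Fin n => r (d x.1) x.2)) := by
  let A : ℕ → Submodule K E := fun t =>
    Submodule.span K ((fun x : Fin k × Fin n => r x.1 x.2) '' {x | (x.2 : ℕ) < t})
  let D : ℕ → Submodule K E := fun t =>
    Submodule.span K ((fun x : Fin dd × Fin n => r (d x.1) x.2) '' {x | (x.2 : ℕ) < t})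
  have hDA : ∀ t, D t ≤ A t := by
    intro t
    refine Submodule.span_mono ?_
    rintro _ ⟨x, hx, rfl⟩
    exact ⟨(d x.1, x.2), hx, rfl⟩
  have key : ∀ t ≤ n, dd * Module.finrank K (A t) ≤ k * Module.finrank K (D t) := by
    intro t
    induction t with
    | zero =>
      intro _
      have hA : A 0 = ⊥ := by simp [A]
      rw [hA, finrank_bot, mul_zero]
      exact Nat.zero_le _
    | succ t ih =>
      intro ht
      have ih := ih (by omega)
      let τ : Fin n := ⟨t, ht⟩
      have hDmono : D t ≤ D (t + 1) :=
        Submodule.span_mono (Set.image_mono fun x (hx : (x.2 : ℕ) < t) => Nat.lt_succ_of_lt hx)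
      by_cases hR : R τ ≤ D (t + 1)
      · have h1 : Module.finrank K ↥(R τ ⊔ D t) ≤ Module.finrank K (D (t + 1)) :=
          Submodule.finrank_mono (sup_le hR hDmono)
        have h2 : Module.finrank K (A (t + 1)) ≤ Module.finrank K ↥(R τ ⊔ A t) := by
          refine Submodule.finrank_mono (Submodule.span_le.2 ?_)
          rintro _ ⟨x, hx, rfl⟩
          rcases Nat.lt_succ_iff_lt_or_eq.1 hx with h | h
          · exact Submodule.mem_sup_right (Submodule.subset_span ⟨x, h, rfl⟩)
          · have : x.2 = τ := Fin.ext h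
            exact Submodule.mem_sup_left (this ▸ hr x.1 x.2)
        have h3 := finrank_sup_add_finrank_le_of_le (R τ) (hDA t)
        have h4 : Module.finrank K (D t) ≤ Module.finrank K (D (t + 1)) :=
          Submodule.finrank_mono hDmono
        nlinarith
      · let L : ℕ → Submodule K E := fun q => Submodule.span K
          ((fun x : Fin dd × Fin n => r (d x.1) x.2) '' {x | x.2 < τ ∨ x.2 = τ ∧ (x.1 : ℕ) < q})
        have hLD : ∀ q, L q ≤ D (t + 1) := by
          intro q
          refine Submodule.span_mono (Set.image_mono ?_)
          rintro x (h | ⟨h, -⟩)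
          · exact Nat.lt_succ_of_lt h
          · simp [h, τ]
        have hq : ∀ q ≤ dd, Module.finrank K (D t) + q ≤ Module.finrank K (L q) := by
          intro q
          induction q with
          | zero =>
            intro _
            exact Submodule.finrank_mono (Submodule.span_mono (Set.image_mono fun x hx => Or.inl hx))
          | succ q ihq =>
            intro hqd
            have ihq := ihq (by omega)
            have hlt : L q < L (q + 1) := by
              refine lt_of_le_of_ne (Submodule.span_mono (Set.image_mono ?_)) fun h => ?_
              · rintro x (h | ⟨h, h'⟩)
                · exact Or.inl h
                · exact Or.inr ⟨h, Nat.lt_succ_of_lt h'⟩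
              · have hnot := (hgen τ ⟨q, hqd⟩).resolve_left fun h' => hR (h'.trans (hLD q))
                refine hnot (?_ : _ ∈ L q)
                rw [h]
                exact Submodule.subset_span
                  ⟨(⟨q, hqd⟩, τ), Or.inr ⟨rfl, Nat.lt_succ_self q⟩, rfl⟩
            have := Submodule.finrank_lt_finrank_of_lt hlt
            omega
        have h1 := hq dd le_rfl
        have h2 := Submodule.finrank_mono (hLD dd)
        have h3 : Module.finrank K (A (t + 1)) ≤ Module.finrank K
            ↥(A t ⊔ Submodule.span K (Set.range fun j => r j τ)) := by
          refine Submodule.finrank_mono (Submodule.span_le.2 ?_)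
          rintro _ ⟨x, hx, rfl⟩
          rcases Nat.lt_succ_iff_lt_or_eq.1 hx with h | h
          · exact Submodule.mem_sup_left (Submodule.subset_span ⟨x, h, rfl⟩)
          · have : x.2 = τ := Fin.ext h
            exact Submodule.mem_sup_right (Submodule.subset_span ⟨x.1, by simp [this]⟩)
        have h4 := Submodule.finrank_add_le_finrank_add_finrank (A t)
          (Submodule.span K (Set.range fun j => r j τ))
        have h5 := finrank_range_le_card (R := K) (fun j => r j τ)
        rw [Fintype.card_fin] at h5
        have h5' : Module.finrank K (Submodule.span K (Set.range fun j => r j τ)) ≤ k := h5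
        nlinarith
  have hA : A n = Submodule.span K (Set.range fun x : Fin k × Fin n => r x.1 x.2) := by
    simp [A]
  have hD : D n = Submodule.span K (Set.range fun x : Fin dd × Fin n => r (d x.1) x.2) := by
    simp [D]
  rw [← hA, ← hD]
  exact key n le_rfl

/-- Membership of a random vector in the span of a random finite family is measurable. -/
theorem measurableSet_mem_span_range {Ω ι κ : Type*} [MeasurableSpace Ω] [Fintype ι] [Fintype κ]
    {w : Ω → ι → κ → ℂ} {v : Ω → κ → ℂ} (hw : Measurable w) (hv : Measurable v) :
    MeasurableSet {ω | v ω ∈ Submodule.span ℂ (Set.range (w ω))} := by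
  let φ : (ι → κ → ℂ) × (ι → ℂ) → (ι → κ → ℂ) × (κ → ℂ) :=
    fun x => (x.1, ∑ i, x.2 i • x.1 i)
  have hφ : Continuous φ := by fun_prop
  have hm : MeasurableSet (Set.range φ) := by
    obtain ⟨s, hs, hsU⟩ := isSigmaCompact_range hφ
    rw [← hsU]
    exact MeasurableSet.iUnion fun n => (hs n).measurableSet
  convert hm.preimage (hw.prodMk hv) using 1
  ext ω
  simp only [Set.mem_ofPred_eq, Set.mem_preimage, Set.mem_range, φ,
    Submodule.mem_span_range_iff_exists_fun, Prod.mk.injEq, Prod.exists]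
  constructor
  · rintro ⟨c, hc⟩
    exact ⟨w ω, c, rfl, hc⟩
  · rintro ⟨_, c, rfl, hc⟩
    exact ⟨c, hc⟩

/-- A measurable set all of whose slices in one coordinate are null is null. -/
theorem measure_pi_eq_zero_of_update {ι : Type*} [Fintype ι] [DecidableEq ι] {X : ι → Type*}
    [∀ i, MeasurableSpace (X i)] (μ : ∀ i, Measure (X i)) [∀ i, SigmaFinite (μ i)]
    {S : Set (∀ i, X i)} (hS : MeasurableSet S) (i : ι)
    (h : ∀ x, μ i {y | Function.update x i y ∈ S} = 0) : Measure.pi μ S = 0 := by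
  rcases isEmpty_or_nonempty (∀ i, X i) with hX | ⟨⟨x₀⟩⟩
  · simp [Set.eq_empty_of_isEmpty S]
  have hf : Measurable (S.indicator (1 : (∀ i, X i) → ENNReal)) := measurable_one.indicator hS
  rw [← lintegral_indicator_one hS, lintegral_eq_lmarginal_univ x₀,
    lmarginal_erase' _ hf (Finset.mem_univ i)]
  have : (fun x : ∀ i, X i => ∫⁻ y, S.indicator (1 : (∀ i, X i) → ENNReal)
      (Function.update x i y) ∂μ i) = fun _ => 0 := by
    funext x
    rw [← h x, ← lintegral_indicator_one (s := {y | Function.update x i y ∈ S}) (measurable_update x hS)]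
    rfl
  rw [this]
  simp [lmarginal]

/-- A measurable set of channels meeting every line parallel to one coordinate axis in at most
one point is null. -/
theorem chanMeasure_eq_zero_of_unique {k m n : ℕ} {μ : Measure ℂ} [SigmaFinite μ] [NullSingletonClass μ]
    {S : Set (Chan k m n)} (hS : MeasurableSet S) (i : Fin k) (t : Fin n) (a : Fin m)
    (h : ∀ g ∈ S, ∀ g' ∈ S, (∀ j, j ≠ i → g j = g' j) → (∀ s, s ≠ t → g i s = g' i s) →
      (∀ b, b ≠ a → g i t b = g' i t b) → g i t a = g' i t a) :
    chanMeasure k m n μ S = 0 := by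
  refine measure_pi_eq_zero_of_update _ hS i fun x => ?_
  refine measure_pi_eq_zero_of_update _ (measurable_update x hS) t fun y => ?_
  refine measure_pi_eq_zero_of_update _
    (measurable_update y (measurable_update x hS)) a fun z => ?_
  refine Set.Subsingleton.measure_zero (fun c hc c' hc' => ?_) μ
  have := h _ hc _ hc' (fun j hj => by simp [hj]) (fun s hs => by simp [hs])
    (fun b hb => by simp [hb])
  simpa using this

namespace Strategy

variable {k m n : ℕ} {I : Fin k → CSITState}

theorem recvS_apply (f : Strategy k m n I) (S : Finset (Fin k)) (j : Fin k) (g : Chan k m n)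
    (t : Fin n) : f.recvS S j g t = ∑ a, g j t a • fun c => f.VS S g (t, a) c := by
  funext c
  simp [recvS, _root_.blockDiag, Matrix.mul_apply, Fintype.sum_prod_type, ite_mul, Finset.sum_ite_irrel]

theorem measurable_VS (f : Strategy k m n I) (S : Finset (Fin k)) (x : Fin n × Fin m) :
    Measurable fun g => f.VS S g x :=
  measurable_pi_lambda _ fun c => f.meas c.1.1 x.1 x.2 c.2

theorem measurable_recvS (f : Strategy k m n I) (S : Finset (Fin k)) (j : Fin k) (t : Fin n) :
    Measurable fun g => f.recvS S j g t := by
  simp only [recvS_apply]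
  refine measurable_pi_lambda _ fun c => ?_
  simp only [Finset.sum_apply, Pi.smul_apply, smul_eq_mul]
  refine Finset.measurable_sum _ fun a _ => Measurable.mul (by fun_prop) ?_
  exact (measurable_pi_apply c).comp (f.measurable_VS S (t, a))

/-- Up to time `t`, the precoders do not react to a time-`t` change of the channel of a
receiver with delayed CSIT. -/
theorem VS_congr_of_delayed (f : Strategy k m n I) (S : Finset (Fin k)) {i : Fin k}
    (hi : I i = CSITState.D) {t s : Fin n} (hst : s ≤ t) {g g' : Chan k m n}
    (h : ∀ j, j ≠ i → g j = g' j) (h' : ∀ u, u ≠ t → g i u = g' i u) (a : Fin m) :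
    f.VS S g (s, a) = f.VS S g' (s, a) := by
  funext c
  refine congrFun (congrFun (f.causal c.1.1 s g g' (fun j hj u _ => ?_) fun j _ u hu => ?_) a) c.2
  · rw [h j (by rintro rfl; simp [hi] at hj)]
  · by_cases hji : j = i
    · subst hji
      exact h' u (by rintro rfl; exact absurd hst (not_le.2 hu))
    · rw [h j hji]

/-- Almost surely the signal received over a channel with delayed CSIT is new relative to the
earlier signals of a family of such receivers, unless those already determine everything sent
in the current slot. -/
theorem ae_generic_of_delayed (f : Strategy k m n I) (S : Finset (Fin k)) {μ : Measure ℂ}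
    [SigmaFinite μ] [NullSingletonClass μ] {dd : ℕ} {d : Fin dd → Fin k} (hd : Function.Injective d)
    (hD : ∀ q, I (d q) = CSITState.D) (t : Fin n) (q : Fin dd) :
    ∀ᵐ g ∂ chanMeasure k m n μ,
      Submodule.span ℂ (Set.range fun a => f.VS S g (t, a)) ≤ Submodule.span ℂ
        ((fun x : Fin dd × Fin n => f.recvS S (d x.1) g x.2) ''
          {x | x.2 < t ∨ x.2 = t ∧ x.1 < q}) ∨
      f.recvS S (d q) g t ∉ Submodule.span ℂ
        ((fun x : Fin dd × Fin n => f.recvS S (d x.1) g x.2) ''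
          {x | x.2 < t ∨ x.2 = t ∧ x.1 < q}) := by
  classical
  simp only [Set.image_eq_range]
  set P : Set (Fin dd × Fin n) := {x | x.2 < t ∨ x.2 = t ∧ x.1 < q} with hP
  let w : Chan k m n → P → _ → ℂ := fun g x => f.recvS S (d x.1.1) g x.1.2
  have hw : Measurable w := measurable_pi_lambda _ fun x => f.measurable_recvS S _ _
  have hnull : ∀ a, ∀ᵐ g ∂ chanMeasure k m n μ,
      ¬ (f.VS S g (t, a) ∉ Submodule.span ℂ (Set.range (w g)) ∧
        f.recvS S (d q) g t ∈ Submodule.span ℂ (Set.range (w g))) := by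
    intro a
    rw [ae_iff]
    simp only [not_not]
    refine chanMeasure_eq_zero_of_unique
      ((measurableSet_mem_span_range hw (f.measurable_VS S (t, a))).compl.inter
        (measurableSet_mem_span_range hw (f.measurable_recvS S (d q) t))) (d q) t a ?_
    rintro g ⟨hg, hgr⟩ g' ⟨-, hgr'⟩ h1 h2 h3
    have hww : w g' = w g := by
      funext ⟨x, hx⟩
      have hxt : x.2 ≤ t := hx.elim le_of_lt fun h => h.1.le
      have hgx : g' (d x.1) x.2 = g (d x.1) x.2 := by
        by_cases hxq : x.1 = q
        · rw [hxq]
          refine (h2 _ ?_).symm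
          rcases hx with hx | hx
          · exact hx.ne
          · exact absurd hxq hx.2.ne
        · rw [h1 _ fun h => hxq (hd h)]
      simp only [w, recvS_apply, hgx]
      refine Finset.sum_congr rfl fun b _ => ?_
      rw [f.VS_congr_of_delayed S (hD q) hxt h1 h2 b]
    rw [hww] at hgr'
    have hdiff : f.recvS S (d q) g t - f.recvS S (d q) g' t
        = (g (d q) t a - g' (d q) t a) • f.VS S g (t, a) := by
      rw [recvS_apply, recvS_apply, ← Finset.sum_sub_distrib, Finset.sum_eq_single a]
      · rw [← f.VS_congr_of_delayed S (hD q) le_rfl h1 h2 a, sub_smul]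
      · intro b _ hb
        rw [← f.VS_congr_of_delayed S (hD q) le_rfl h1 h2 b, h3 b hb, sub_self]
      · simp
    by_contra hne
    refine hg ((Submodule.smul_mem_iff _ (sub_ne_zero.2 hne)).1 ?_)
    rw [← hdiff]
    exact Submodule.sub_mem _ hgr hgr'
  filter_upwards [ae_all_iff.2 hnull] with g hg
  by_cases hr : f.recvS S (d q) g t ∈ Submodule.span ℂ (Set.range (w g))
  · refine Or.inl (Submodule.span_le.2 ?_)
    rintro _ ⟨a, rfl⟩
    by_contra hn
    exact hg a ⟨hn, hr⟩
  · exact Or.inr hr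

end Strategy

/-- **Claim 2.** With `𝒫 = {1,…,p}`, `𝒟 = {p+1,…,p+dd}` (`dd ≥ 1`) and
`𝒩 = {p+dd+1,…,k}`, for every linear coding strategy, almost surely
`rank[[G_1^n; …; G_k^n][V_1^n … V_p^n]]/k
  ≤ rank[[G_{p+1}^n; …; G_{p+dd}^n][V_1^n … V_p^n]]/dd`. -/
theorem claim_joint_rank_ratio (k m n p dd : ℕ) (hkm : k ≤ m)
    (hdd : 1 ≤ dd) (hpd : p + dd ≤ k) (I : Fin k → CSITState)
    (hP : ∀ i : Fin k, (i : ℕ) < p → I i = CSITState.P)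
    (hD : ∀ i : Fin k, p ≤ (i : ℕ) → (i : ℕ) < p + dd → I i = CSITState.D)
    (hN : ∀ i : Fin k, p + dd ≤ (i : ℕ) → I i = CSITState.N)
    (μ : Measure ℂ) [IsProbabilityMeasure μ] (hac : μ ≪ (volume : Measure ℂ))
    (f : Strategy k m n I) :
    ∀ᵐ g ∂ chanMeasure k m n μ,
      ((Matrix.of fun (q : Fin k × Fin n)
            (c : (i : {x // x ∈ Finset.univ.filter fun i : Fin k => (i : ℕ) < p}) ×
                Fin (f.dim i.1)) =>
            f.recvS (Finset.univ.filter fun i : Fin k => (i : ℕ) < p) q.1 g q.2 c).rank : ℝ)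
          / k
        ≤ ((Matrix.of fun (q : Fin dd × Fin n)
            (c : (i : {x // x ∈ Finset.univ.filter fun i : Fin k => (i : ℕ) < p}) ×
                Fin (f.dim i.1)) =>
            f.recvS (Finset.univ.filter fun i : Fin k => (i : ℕ) < p)
              ⟨p + (q.1 : ℕ), by have := q.1.isLt; omega⟩ g q.2 c).rank : ℝ) / dd := by
  have hna : NullSingletonClass μ := ⟨fun x => hac (measure_singleton x)⟩
  set S := Finset.univ.filter fun i : Fin k => (i : ℕ) < p
  let d : Fin dd → Fin k := fun q => ⟨p + (q : ℕ), by have := q.isLt; omega⟩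
  have hd : Function.Injective d := fun q q' h => by
    have : p + (q : ℕ) = p + (q' : ℕ) := congrArg Fin.val h
    exact Fin.ext (by omega)
  have hdD : ∀ q, I (d q) = CSITState.D := fun q =>
    hD _ (Nat.le_add_right _ _) (Nat.add_lt_add_left q.isLt p)
  filter_upwards [ae_all_iff.2 fun t => ae_all_iff.2 fun q =>
    f.ae_generic_of_delayed S (μ := μ) hd hdD t q] with g hg
  have key := mul_finrank_span_le_of_generic (by omega : dd ≤ k)
    (fun t => Submodule.span ℂ (Set.range fun a => f.VS S g (t, a)))
    (fun j t => f.recvS S j g t) d (fun j t => by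
      simp only [Strategy.recvS_apply]
      exact Submodule.sum_mem _ fun a _ =>
        Submodule.smul_mem _ _ (Submodule.subset_span ⟨a, rfl⟩)) hg
  have hk : (0 : ℝ) < k := by exact_mod_cast (by omega : 0 < k)
  have hdd' : (0 : ℝ) < dd := by exact_mod_cast hdd
  rw [div_le_div_iff₀ hk hdd', Matrix.rank_eq_finrank_span_row, Matrix.rank_eq_finrank_span_row]
  rw [mul_comm dd, mul_comm k] at key
  exact_mod_cast key

end
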